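/- Under the genericity assumptions, (g+1)C_g < C_{−1} − (g+1)C_g, and the closed vertical segment {(C_g, Y) : (g+1)C_g ≤ Y ≤ C_{−1} − (g+1)C_g}, which is the edge of Γ̃ joining V_0′ = (C_g, (g+1)C_g) and V_0 = (C_g, C_{−1} − (g+1)C_g), is entirely contained in Γ̃; i.e., F is not differentiable at any point of this segment. -/

import Mathlib

/-- The tropical polynomial
`F(X,Y) = min(2Y, Y + min((g+1)X, C_g + gX, …, C_1 + X, C_0), C_{-1})`. -/
noncomputable def tropF (g : ℕ) (Cm1 : ℝ) (C : ℕ → ℝ) (P : ℝ × ℝ) : ℝ :=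
  min (2 * P.2)
    (min
      (P.2 + min (((g : ℝ) + 1) * P.1)
        ((Finset.range (g + 1)).inf' ⟨0, Finset.mem_range.mpr (Nat.succ_pos g)⟩
          (fun i => C i + (i : ℝ) * P.1)))
      Cm1)

/-- Convexity of the coefficients propagates the gap `C (g - 1) - C g > C g` down to every
consecutive pair of coefficients. -/
lemma lt_sub_succ_of_convex {g : ℕ} {C : ℕ → ℝ} (hg : 1 ≤ g) (h2 : C (g - 1) > 2 * C g)
    (h3 : ∀ i, i + 2 ≤ g → C i + C (i + 2) > 2 * C (i + 1)) {i : ℕ} (hi : i + 1 ≤ g) :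
    C g < C i - C (i + 1) := by
  obtain ⟨n, rfl⟩ : ∃ n, g = n + 1 := ⟨g - 1, by omega⟩
  have hin : i ≤ n := by omega
  induction hin using Nat.decreasingInduction with
  | self =>
    simp only [Nat.add_sub_cancel] at h2
    linarith
  | of_succ k hk ih =>
    have := ih (by omega)
    have := h3 k (by omega)
    linarith

/-- At `X = C g` the monomial `C i + i X` is at least `(g + 1) X`. -/
lemma succ_mul_le_add_mul_of_convex {g : ℕ} {C : ℕ → ℝ} (hg : 1 ≤ g) (h2 : C (g - 1) > 2 * C g)
    (h3 : ∀ i, i + 2 ≤ g → C i + C (i + 2) > 2 * C (i + 1)) {i : ℕ} (hi : i ≤ g) :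
    ((g : ℝ) + 1) * C g ≤ C i + (i : ℝ) * C g := by
  induction hi using Nat.decreasingInduction with
  | self => linarith
  | of_succ k hk ih =>
    have := lt_sub_succ_of_convex hg h2 h3 (i := k) (by omega)
    push_cast at ih
    linarith

lemma tropF_le_top_monomial (g : ℕ) (Cm1 : ℝ) (C : ℕ → ℝ) (X Y : ℝ) :
    tropF g Cm1 C (X, Y) ≤ Y + ((g : ℝ) + 1) * X :=
  (min_le_right _ _).trans <| (min_le_left _ _).trans <| add_le_add_right (min_le_left _ _) Y

lemma tropF_le_monomial {g : ℕ} (Cm1 : ℝ) (C : ℕ → ℝ) (X Y : ℝ) {i : ℕ} (hi : i ≤ g) :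
    tropF g Cm1 C (X, Y) ≤ Y + (C i + (i : ℝ) * X) :=
  (min_le_right _ _).trans <| (min_le_left _ _).trans <|
    add_le_add_right ((min_le_right _ _).trans
      (Finset.inf'_le (fun i : ℕ => C i + (i : ℝ) * X) (Finset.mem_range.mpr (by omega)))) Y

/-- A function that is differentiable at a point where it touches an affine function from below
has the slope of that affine function there. -/
lemma HasDerivAt.eq_slope_of_le_affine {f : ℝ → ℝ} {m a b x : ℝ} (hf : HasDerivAt f m x)
    (hle : ∀ t, f t ≤ a + b * t) (hx : f x = a + b * x) : m = b := by
  have hd : HasDerivAt (fun t => f t - b * t) (m - b * 1) x :=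
    hf.sub ((hasDerivAt_id x).const_mul b)
  have hmax : IsLocalMax (fun t => f t - b * t) x :=
    Filter.Eventually.of_forall fun t => by
      have := hle t
      simp only
      linarith
  linarith [hmax.hasDerivAt_eq_zero hd]

/-- Under the genericity assumptions, `(g+1)C_g < C_{-1} - (g+1)C_g`, and the
whole closed vertical segment `{(C_g, Y) : (g+1)C_g ≤ Y ≤ C_{-1} - (g+1)C_g}`
joining `V_0' = (C_g, (g+1)C_g)` and `V_0 = (C_g, C_{-1} - (g+1)C_g)` is
contained in the tropical curve `Γ̃`, i.e. `F` is not differentiable at any of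
its points. -/
theorem tropF_vertical_edge (g : ℕ) (hg : 1 ≤ g) (Cm1 : ℝ) (C : ℕ → ℝ)
    (h1 : Cm1 > 2 * C 0) (h2 : C (g - 1) > 2 * C g)
    (h3 : ∀ i, i + 2 ≤ g → C i + C (i + 2) > 2 * C (i + 1)) :
    ((g : ℝ) + 1) * C g < Cm1 - ((g : ℝ) + 1) * C g ∧
    ∀ Y : ℝ, ((g : ℝ) + 1) * C g ≤ Y → Y ≤ Cm1 - ((g : ℝ) + 1) * C g →
      ¬ DifferentiableAt ℝ (tropF g Cm1 C) (C g, Y) := by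
  have hmono : ∀ i, i ≤ g → ((g : ℝ) + 1) * C g ≤ C i + (i : ℝ) * C g :=
    fun i hi => succ_mul_le_add_mul_of_convex hg h2 h3 hi
  refine ⟨?_, fun Y hY hY' hdiff => ?_⟩
  · have := hmono 0 (Nat.zero_le g)
    push_cast at this
    linarith
  have hval : tropF g Cm1 C (C g, Y) = Y + ((g : ℝ) + 1) * C g := by
    refine le_antisymm (tropF_le_top_monomial g Cm1 C _ _) ?_
    refine le_min (by linarith) (le_min (add_le_add_right (le_min le_rfl ?_) Y) (by linarith))
    exact Finset.le_inf' _ _ fun i hi => hmono i (Nat.lt_succ_iff.mp (Finset.mem_range.mp hi))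
  have hline : DifferentiableAt ℝ (fun X : ℝ => tropF g Cm1 C (X, Y)) (C g) :=
    DifferentiableAt.comp (C g) (f := fun X : ℝ => (X, Y)) hdiff (by fun_prop)
  have hsucc := hline.hasDerivAt.eq_slope_of_le_affine
    (fun X => tropF_le_top_monomial g Cm1 C X Y) hval
  have hg' := hline.hasDerivAt.eq_slope_of_le_affine (a := Y + C g) (b := g)
    (fun X => (tropF_le_monomial Cm1 C X Y le_rfl).trans_eq (by ring)) (by rw [hval]; ring)
  linarith
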